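/- Let K be a field and R = K[X_1, X_2, Y_1, Y_2, Y_3] with I = (X_1^3, X_2^3, X_1^2 Y_1 + X_1 X_2 Y_2 + X_2^2 Y_3). Then pd_R(R/I) = 5, equal to the number of variables of R; in particular, there exists an ideal generated by 3 cubics with projective dimension 5. -/

import Mathlib

open CategoryTheory MvPolynomial

/-- The projective dimension of a module `M` over `R`: the infimum, over all
projective resolutions `P` of `M`, of the length of `P` (the supremum of the
degrees where the resolution is nonzero), as an element of `ℕ∞`. -/
noncomputable def projDim (R : Type*) [CommRing R] (M : Type*) [AddCommGroup M]
    [Module R M] : ℕ∞ :=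
  sInf {c : ℕ∞ | ∃ P : ProjectiveResolution (ModuleCat.of R M),
    ∀ i : ℕ, c < i → Subsingleton (P.complex.X i)}

universe v u

namespace CategoryTheory

variable {C : Type u} [Category.{v} C] [Abelian C]

lemma ProjectiveResolution.hasProjectiveDimensionLT {X : C} (P : ProjectiveResolution X) (n : ℕ)
    (h : ∀ i, n ≤ i → Limits.IsZero (P.complex.X i)) : HasProjectiveDimensionLT X n := by
  let := HasExt.standard C
  rw [hasProjectiveDimensionLT_iff]
  intro i hi Y e
  obtain ⟨f, hf, rfl⟩ := P.extMk_surjective e (i + 1) rfl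
  obtain rfl : f = 0 := (h i hi).eq_of_src _ _
  simp

lemma ShortComplex.exact_epi_comp_iff {S : ShortComplex C} {A : C} (e : A ⟶ S.X₁) [Epi e] :
    (ShortComplex.mk (e ≫ S.f) S.g (by simp)).Exact ↔ S.Exact :=
  ShortComplex.exact_iff_of_epi_of_isIso_of_mono
    (S₁ := ShortComplex.mk (e ≫ S.f) S.g (by simp)) (S₂ := S)
    { τ₁ := e, τ₂ := 𝟙 _, τ₃ := 𝟙 _ }

lemma ShortComplex.exact_comp_mono_iff {S : ShortComplex C} {A : C} (m : S.X₃ ⟶ A) [Mono m] :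
    (ShortComplex.mk S.f (S.g ≫ m) (by simp)).Exact ↔ S.Exact :=
  (ShortComplex.exact_iff_of_epi_of_isIso_of_mono
    (S₁ := S) (S₂ := ShortComplex.mk S.f (S.g ≫ m) (by simp))
    { τ₁ := 𝟙 _, τ₂ := 𝟙 _, τ₃ := m }).symm

/-- The augmentation of a projective resolution. -/
noncomputable def ProjectiveResolution.augmentation {X : C} (P : ProjectiveResolution X) :
    P.complex.X 0 ⟶ X :=
  P.π.f 0

instance {X : C} (P : ProjectiveResolution X) : Epi P.augmentation :=
  inferInstanceAs (Epi (P.π.f 0))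

lemma ProjectiveResolution.d_comp_augmentation {X : C} (P : ProjectiveResolution X) :
    P.complex.d 1 0 ≫ P.augmentation = 0 :=
  P.complex_d_comp_π_f_zero

lemma ProjectiveResolution.exact_augmentation {X : C} (P : ProjectiveResolution X) :
    (ShortComplex.mk _ _ P.d_comp_augmentation).Exact :=
  P.exact₀

/-- The projective resolution of the last term of a short exact sequence with projective middle
term obtained by splicing that sequence with a projective resolution of its first term. -/
noncomputable def ProjectiveResolution.splice {S : ShortComplex C} (hS : S.ShortExact)
    [Projective S.X₂] (Q : ProjectiveResolution S.X₁) : ProjectiveResolution S.X₃ where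
  complex := Q.complex.augment (Q.augmentation ≫ S.f)
    (by rw [← Category.assoc, Q.d_comp_augmentation, Limits.zero_comp])
  projective
    | 0 => ‹Projective S.X₂›
    | n + 1 => Q.projective n
  π := (ChainComplex.toSingle₀Equiv _ _).symm ⟨S.g, by
    rw [ChainComplex.augment_d_one_zero]
    exact (Category.assoc _ _ _).trans ((congrArg _ S.zero).trans Limits.comp_zero)⟩
  hasHomology := inferInstance
  quasiIso := ⟨fun n => by
    have := hS.epi_g
    have := hS.mono_f
    match n with
    | 0 =>
      rw [ChainComplex.quasiIsoAt₀_iff, ShortComplex.quasiIso_iff_of_zeros' _ rfl rfl rfl]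
      suffices H : ∀ (g : S.X₂ ⟶ S.X₃) (w : (Q.augmentation ≫ S.f) ≫ g = 0), g = S.g →
          (ShortComplex.mk (Q.augmentation ≫ S.f) g w).Exact ∧ Epi g from
        H _ _ (ChainComplex.toSingle₀Equiv_symm_apply_f_zero _ _)
      rintro _ _ rfl
      exact ⟨(ShortComplex.exact_epi_comp_iff Q.augmentation).mpr hS.exact, hS.epi_g⟩
    | 1 =>
      rw [quasiIsoAt_iff_exactAt' _ _ (ChainComplex.exactAt_succ_single_obj _ _),
        HomologicalComplex.exactAt_iff' _ 2 1 0 (by simp) (by simp)]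
      exact (ShortComplex.exact_comp_mono_iff
        (S := ShortComplex.mk _ _ Q.d_comp_augmentation) S.f).mpr Q.exact_augmentation
    | n + 2 =>
      rw [quasiIsoAt_iff_exactAt' _ _ (ChainComplex.exactAt_succ_single_obj _ _),
        HomologicalComplex.exactAt_iff' _ (n + 3) (n + 2) (n + 1) (by simp) (by simp)]
      exact Q.exact_succ n⟩

lemma HasProjectiveDimensionLE.exists_projectiveResolution [EnoughProjectives C] (n : ℕ) (X : C)
    [HasProjectiveDimensionLE X n] :
    ∃ P : ProjectiveResolution X, ∀ i, n < i → Limits.IsZero (P.complex.X i) := by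
  induction n generalizing X with
  | zero =>
    have : Projective X := projective_iff_hasProjectiveDimensionLT_one.mpr ‹_›
    exact ⟨ProjectiveResolution.self X, fun i hi ↦
      HomologicalComplex.isZero_single_obj_X _ _ _ _ hi.ne'⟩
  | succ n ih =>
    have hS : (ShortComplex.mk _ _ (Limits.kernel.condition (Projective.π X))).ShortExact :=
      { exact := ShortComplex.exact_kernel _ }
    have : HasProjectiveDimensionLE (Limits.kernel (Projective.π X)) n :=
      (hS.hasProjectiveDimensionLT_X₃_iff n (Projective.projective_over X)).mp ‹_›
    obtain ⟨Q, hQ⟩ := ih (Limits.kernel (Projective.π X))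
    have : Projective (ShortComplex.mk _ _ (Limits.kernel.condition (Projective.π X))).X₂ :=
      Projective.projective_over X
    refine ⟨Q.splice hS, fun i hi ↦ ?_⟩
    obtain ⟨i, rfl⟩ := Nat.exists_eq_succ_of_ne_zero (Nat.ne_zero_of_lt hi)
    exact hQ i (by lia)

end CategoryTheory

lemma projDim_eq_of_hasProjectiveDimensionLE {R : Type u} {M : Type u} [CommRing R]
    [AddCommGroup M] [Module R M] (n : ℕ) [HasProjectiveDimensionLE (ModuleCat.of R M) n]
    (h : ¬ HasProjectiveDimensionLT (ModuleCat.of R M) n) : projDim R M = n := by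
  refine le_antisymm (sInf_le ?_) (le_sInf ?_)
  · obtain ⟨P, hP⟩ := HasProjectiveDimensionLE.exists_projectiveResolution n (ModuleCat.of R M)
    exact ⟨P, fun i hi ↦ ModuleCat.subsingleton_of_isZero (hP i (by exact_mod_cast hi))⟩
  · rintro c ⟨P, hP⟩
    by_contra! hc
    refine h (P.hasProjectiveDimensionLT n fun i hi ↦ ?_)
    have := hP i (hc.trans_le (by exact_mod_cast hi))
    exact ModuleCat.isZero_of_subsingleton _


open scoped TensorProduct Polynomial in
lemma ModuleCat.hasProjectiveDimensionLE_baseChange {A B : Type u} [CommRing A] [CommRing B]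
    [Algebra A B] [Module.Flat A B] (n : ℕ) (M : Type u) [AddCommGroup M] [Module A M]
    [HasProjectiveDimensionLE (ModuleCat.of A M) n] :
    HasProjectiveDimensionLE (ModuleCat.of B (B ⊗[A] M)) n := by
  induction n generalizing M with
  | zero =>
    have : HasProjectiveDimensionLE (ModuleCat.of A M) 0 := ‹_›
    simp only [HasProjectiveDimensionLE, zero_add] at this ⊢
    rw [← projective_iff_hasProjectiveDimensionLT_one, ← IsProjective.iff_projective] at this ⊢
    infer_instance
  | succ n ih =>
    obtain ⟨P, _, _, _, f, hf⟩ : ∃ (P : Type u) (_ : AddCommGroup P) (_ : Module A P)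
        (_ : Module.Projective A P) (f : P →ₗ[A] M), Function.Surjective f :=
      ⟨M →₀ A, inferInstance, inferInstance, inferInstance, Finsupp.linearCombination A id,
        Finsupp.linearCombination_id_surjective A M⟩
    have hS := LinearMap.shortExact_shortComplexKer hf
    have : HasProjectiveDimensionLE (ModuleCat.of A f.ker) n :=
      (hS.hasProjectiveDimensionLT_X₃_iff n
        (ModuleCat.projective_of_categoryTheory_projective (ModuleCat.of A P))).mp ‹_›
    let T : ShortComplex (ModuleCat B) := ShortComplex.mk
      (ModuleCat.ofHom (f.ker.subtype.baseChange B)) (ModuleCat.ofHom (f.baseChange B)) (by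
        rw [← ModuleCat.ofHom_comp, ← LinearMap.baseChange_comp, f.comp_ker_subtype,
          LinearMap.baseChange_zero, ModuleCat.ofHom_zero])
    have hex : Function.Exact (f.ker.subtype.baseChange B) (f.baseChange B) := 
      lTensor_exact B f.exact_subtype_ker_map hf
    have hT : T.ShortExact :=
      { exact := (ShortComplex.ShortExact.moduleCat_exact_iff_function_exact _).mpr hex
        mono_f := (ModuleCat.mono_iff_injective _).mpr
          (Module.Flat.lTensor_preserves_injective_linearMap _ f.ker.subtype_injective)
        epi_g := (ModuleCat.epi_iff_surjective _).mpr (LinearMap.lTensor_surjective B hf) }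
    exact (hT.hasProjectiveDimensionLT_X₃_iff n
      (ModuleCat.projective_of_categoryTheory_projective
        (ModuleCat.of B (B ⊗[A] P)))).mpr (ih f.ker)

section

open scoped TensorProduct Polynomial

variable {A M : Type*} [CommRing A] [AddCommGroup M] [Module A M] [Module A[X] M]
  [IsScalarTower A A[X] M]

namespace Polynomial

variable (A M) in
/-- The endomorphism `p ⊗ m ↦ X p ⊗ m - p ⊗ X m` of `A[X] ⊗[A] M`. -/
noncomputable def tensorSubX : A[X] ⊗[A] M →ₗ[A[X]] A[X] ⊗[A] M :=
  (X : A[X]) • LinearMap.id -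
    LinearMap.baseChange A[X] (((LinearMap.lsmul A[X] M) X).restrictScalars A)

variable (A M) in
/-- The scalar multiplication map `p ⊗ m ↦ p m`. -/
noncomputable def tensorSMul : A[X] ⊗[A] M →ₗ[A[X]] M :=
  LinearMap.liftBaseChange A[X] LinearMap.id

@[simp]
lemma tensorSubX_tmul (p : A[X]) (m : M) :
    tensorSubX A M (p ⊗ₜ m) = (X * p) ⊗ₜ m - p ⊗ₜ[A] ((X : A[X]) • m) := by
  simp [tensorSubX, TensorProduct.smul_tmul']

@[simp]
lemma tensorSMul_tmul (p : A[X]) (m : M) : tensorSMul A M (p ⊗ₜ m) = p • m := by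
  simp [tensorSMul]

lemma tensorSMul_surjective : Function.Surjective (tensorSMul A M) :=
  fun m ↦ ⟨1 ⊗ₜ m, by simp⟩

lemma sub_one_tmul_tensorSMul_mem_range (z : A[X] ⊗[A] M) :
    z - 1 ⊗ₜ tensorSMul A M z ∈ (tensorSubX A M).range := by
  induction z with
  | zero => simp
  | add z w hz hw =>
    convert add_mem hz hw using 1
    rw [map_add, TensorProduct.tmul_add]
    abel
  | tmul p m =>
    have key (z : A[X] ⊗[A] M) (hz : z - 1 ⊗ₜ tensorSMul A M z ∈ (tensorSubX A M).range) :
        (X : A[X]) • z - 1 ⊗ₜ tensorSMul A M ((X : A[X]) • z) ∈ (tensorSubX A M).range := by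
      convert add_mem (Submodule.smul_mem _ (X : A[X]) hz)
        (LinearMap.mem_range_self (tensorSubX A M) (1 ⊗ₜ tensorSMul A M z)) using 1
      simp [smul_sub, TensorProduct.smul_tmul']
    induction p using Polynomial.induction_on with
    | C a =>
      convert (tensorSubX A M).range.zero_mem
      rw [tensorSMul_tmul, ← algebraMap_eq, algebraMap_smul, TensorProduct.tmul_smul,
        TensorProduct.smul_tmul', Algebra.algebraMap_eq_smul_one, sub_self]
    | add p q hp hq =>
      convert add_mem hp hq using 1
      rw [TensorProduct.add_tmul, map_add, TensorProduct.tmul_add]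
      abel
    | monomial n a h =>
      have : (C a * X ^ (n + 1)) ⊗ₜ[A] m = (X : A[X]) • ((C a * X ^ n) ⊗ₜ[A] m) := by
        rw [TensorProduct.smul_tmul', smul_eq_mul]
        ring_nf
      rw [this]
      exact key _ h

lemma exact_tensorSubX_tensorSMul : Function.Exact (tensorSubX A M) (tensorSMul A M) := by
  rw [LinearMap.exact_iff]
  apply le_antisymm
  · intro z hz
    have := sub_one_tmul_tensorSMul_mem_range z
    rwa [LinearMap.mem_ker.mp hz, TensorProduct.tmul_zero, sub_zero] at this
  · rw [LinearMap.range_le_ker_iff]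
    ext m
    simp

lemma tensorSubX_injective : Function.Injective (tensorSubX A M) := by
  rw [injective_iff_map_eq_zero]
  intro z hz
  let e := PolynomialModule.polynomialTensorProductLEquivPolynomialModule A M
  let x : M →ₗ[A] M := ((LinearMap.lsmul A[X] M) X).restrictScalars A
  have h₁ (w : A[X] ⊗[A] M) (n : ℕ) : (e ((X : A[X]) • w)).coeff (n + 1) = (e w).coeff n := by
    rw [map_smul, ← monomial_one_one_eq_X, PolynomialModule.monomial_smul_apply]
    simp
  have h₂ (w : A[X] ⊗[A] M) (n : ℕ) :
      (e (x.baseChange A[X] w)).coeff n = x ((e w).coeff n) := by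
    induction w with
    | zero => simp
    | add w w' h h' => simp_all
    | tmul p m =>
      simp [e, PolynomialModule.polynomialTensorProductLEquivPolynomialModule,
        PolynomialModule.lsingle]
  have h₃ (n : ℕ) : (e z).coeff n = x ((e z).coeff (n + 1)) := by
    rw [← h₁, ← h₂]
    congr 2
    exact congrArg e (sub_eq_zero.mp hz)
  have h₄ (n k : ℕ) : (e z).coeff n = (x ^ k) ((e z).coeff (n + k)) := by
    induction k with
    | zero => simp
    | succ k ih => rw [ih, h₃ (n + k), pow_succ, Module.End.mul_apply, add_assoc]
  apply e.injective
  rw [map_zero]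
  ext n
  obtain ⟨N, hN⟩ := (e z).coeff.support.bddAbove
  rw [h₄ n (N + 1), Finsupp.notMem_support_iff.mp fun h ↦ by have := hN h; lia]
  simp

end Polynomial

end

open scoped TensorProduct Polynomial in
lemma Polynomial.hasProjectiveDimensionLE {A : Type u} [CommRing A] (n : ℕ)
    (hA : ∀ (M : Type u) [AddCommGroup M] [Module A M],
      HasProjectiveDimensionLE (ModuleCat.of A M) n)
    (M : Type u) [AddCommGroup M] [Module A[X] M] :
    HasProjectiveDimensionLE (ModuleCat.of A[X] M) (n + 1) := by
  let : Module A M := Module.compHom M (algebraMap A A[X])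
  have : IsScalarTower A A[X] M := IsScalarTower.of_compHom A A[X] M
  have := hA M
  let T : ShortComplex (ModuleCat A[X]) := ShortComplex.mk
    (ModuleCat.ofHom (tensorSubX A M)) (ModuleCat.ofHom (tensorSMul A M)) (by
      ext : 1
      exact exact_tensorSubX_tensorSMul.linearMap_comp_eq_zero)
  have hT : T.ShortExact :=
    { exact := (ShortComplex.ShortExact.moduleCat_exact_iff_function_exact _).mpr
        exact_tensorSubX_tensorSMul
      mono_f := (ModuleCat.mono_iff_injective _).mpr tensorSubX_injective
      epi_g := (ModuleCat.epi_iff_surjective _).mpr tensorSMul_surjective }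
  have h : HasProjectiveDimensionLE (ModuleCat.of A[X] (A[X] ⊗[A] M)) n :=
    ModuleCat.hasProjectiveDimensionLE_baseChange n M
  exact hT.hasProjectiveDimensionLT_X₃ (n + 1) h
    (hasProjectiveDimensionLT_of_ge _ (n + 1) _ (by lia))

attribute [local instance] RingHomInvPair.of_ringEquiv in
lemma ModuleCat.hasProjectiveDimensionLE_of_ringEquiv {A B : Type u} [CommRing A] [CommRing B]
    (e : A ≃+* B) (n : ℕ) (hA : ∀ (M : Type u) [AddCommGroup M] [Module A M],
      HasProjectiveDimensionLE (ModuleCat.of A M) n)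
    (M : Type u) [AddCommGroup M] [Module B M] :
    HasProjectiveDimensionLE (ModuleCat.of B M) n := by
  let : Module A M := Module.compHom M e.toRingHom
  have := hA M
  let e' : ModuleCat.of A M ≃ₛₗ[RingHomClass.toRingHom e] ModuleCat.of B M :=
    { AddEquiv.refl M with map_smul' := fun _ _ ↦ rfl }
  exact ModuleCat.hasProjectiveDimensionLE_of_semiLinearEquiv e e' n

lemma MvPolynomial.hasProjectiveDimensionLE (K : Type u) [Field K] (n : ℕ) (M : Type u)
    [AddCommGroup M] [Module (MvPolynomial (Fin n) K) M] :
    HasProjectiveDimensionLE (ModuleCat.of (MvPolynomial (Fin n) K) M) n := by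
  induction n generalizing M with
  | zero =>
    refine ModuleCat.hasProjectiveDimensionLE_of_ringEquiv (isEmptyRingEquiv K (Fin 0)).symm 0
      (fun M _ _ ↦ ?_) M
    rw [HasProjectiveDimensionLE, zero_add, ← projective_iff_hasProjectiveDimensionLT_one]
    exact ModuleCat.projective_of_categoryTheory_projective (ModuleCat.of K M)
  | succ n ih =>
    exact ModuleCat.hasProjectiveDimensionLE_of_ringEquiv (finSuccEquiv K n).symm.toRingEquiv
      (n + 1) (Polynomial.hasProjectiveDimensionLE n fun M _ _ ↦ ih M) M


lemma MvPolynomial.mem_span_X_image_of_X_mul_mem {σ R : Type*} [CommSemiring R] {s : Set σ} {i : σ}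
    (hi : i ∉ s) {p : MvPolynomial σ R} (hp : X i * p ∈ Ideal.span (X '' s)) :
    p ∈ Ideal.span (X '' s) := by
  rw [mem_ideal_span_X_image] at hp ⊢
  intro m hm
  obtain ⟨j, hj, h⟩ := hp (Finsupp.single i 1 + m) (by
    rwa [mem_support_iff, coeff_X_mul, ← mem_support_iff])
  refine ⟨j, hj, ?_⟩
  rwa [Finsupp.add_apply, Finsupp.single_eq_of_ne (ne_of_mem_of_not_mem hj hi), zero_add] at h

lemma MvPolynomial.isWeaklyRegular_ofFn_X (R : Type*) [CommRing R] (n : ℕ) :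
    RingTheory.Sequence.IsWeaklyRegular (MvPolynomial (Fin n) R)
      (List.ofFn (X : Fin n → MvPolynomial (Fin n) R)) := by
  rw [RingTheory.Sequence.isWeaklyRegular_iff]
  intro i hi
  have hin : i < n := by simpa using hi
  have h : Ideal.ofList ((List.ofFn (X : Fin n → MvPolynomial (Fin n) R)).take i) =
      Ideal.span (X '' {j : Fin n | j.1 < i}) := by
    refine congrArg Ideal.span (Set.ext fun p ↦ ?_)
    change p ∈ (List.ofFn X).take i ↔ _
    simp only [List.mem_take_iff_getElem, List.getElem_ofFn, List.length_ofFn, Set.mem_image]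
    constructor
    · rintro ⟨j, hj, rfl⟩
      exact ⟨⟨j, by lia⟩, by simp; lia, rfl⟩
    · rintro ⟨j, hj, rfl⟩
      exact ⟨j, lt_min hj j.2, rfl⟩
  rw [h, isSMulRegular_quotient_iff_mem_of_smul_mem]
  intro p hp
  rw [smul_eq_mul, Ideal.mul_top, List.getElem_ofFn, smul_eq_mul] at hp
  rw [smul_eq_mul, Ideal.mul_top]
  exact mem_span_X_image_of_X_mul_mem (by simp) hp

lemma MvPolynomial.ker_constantCoeff_eq_idealOfVars (σ R : Type*) [CommRing R] :
    RingHom.ker (constantCoeff : MvPolynomial σ R →+* R) = idealOfVars σ R := by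
  apply le_antisymm
  · intro p hp
    rw [idealOfVars, ← Set.image_univ, mem_ideal_span_X_image]
    intro m hm
    by_contra! h
    obtain rfl : m = 0 := Finsupp.ext fun i ↦ h i trivial
    exact mem_support_iff.mp hm hp
  · rw [idealOfVars, Ideal.span_le]
    rintro _ ⟨i, rfl⟩
    exact constantCoeff_X R i

instance MvPolynomial.isMaximal_idealOfVars (σ K : Type*) [Field K] :
    (idealOfVars σ K).IsMaximal := by
  rw [← ker_constantCoeff_eq_idealOfVars]
  exact RingHom.ker_isMaximal_of_surjective _ fun a ↦ ⟨C a, constantCoeff_C σ a⟩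

namespace ModuleCat

open Abelian RingTheory.Sequence

variable {A : Type u} [CommRing A] [IsNoetherianRing A] {I : Ideal A} {rs : List A}

lemma subsingleton_ext_quotient_pi (hI : I ≠ ⊤) (mem : ∀ r ∈ rs, r ∈ I)
    (reg : IsWeaklyRegular A rs) (k i : ℕ) (hi : i < rs.length) :
    Subsingleton (Ext (of A (A ⧸ I)) (of A (Fin k → A)) i) := by
  rcases k.eq_zero_or_pos with rfl | hk
  · have : Limits.IsZero (of A (Fin 0 → A)) := isZero_of_subsingleton _
    refine subsingleton_of_forall_eq 0 fun x ↦ ?_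
    rw [← x.comp_mk₀_id, this.eq_of_src (𝟙 _) 0, Ext.mk₀_zero, Ext.comp_zero]
  have hlt : I • (⊤ : Submodule A (Fin k → A)) < ⊤ := by
    refine lt_top_iff_ne_top.mpr fun h ↦ hI ?_
    have hp : Function.Surjective (LinearMap.proj ⟨0, hk⟩ : (Fin k → A) →ₗ[A] A) :=
      LinearMap.proj_surjective _
    have := congrArg (Submodule.map (LinearMap.proj ⟨0, hk⟩)) h
    rwa [Submodule.map_smul'', Submodule.map_top, LinearMap.range_eq_top.mpr hp, smul_eq_mul,
      Ideal.mul_top] at this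
  have hle : Ideal.ofList rs ≤ I := Ideal.span_le.mpr mem
  have hreg : IsRegular (Fin k → A) rs :=
    { ((TensorProduct.rid A (Fin k → A)).isWeaklyRegular_congr rs).mp
        reg.isWeaklyRegular_lTensor with
      top_ne_smul := ((Submodule.smul_mono_left hle).trans_lt hlt).ne' }
  refine subsingleton_ext_of_exists_isRegular I (of A (A ⧸ I)) ?_ (of A (Fin k → A)) hlt rs mem
    hreg i hi
  rw [Module.support_eq_zeroLocus]
  exact PrimeSpectrum.zeroLocus_anti_mono (Ideal.annihilator_quotient (I := I)).ge

lemma not_hasProjectiveDimensionLT_quotient_of_isWeaklyRegular (hI : I ≠ ⊤)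
    (mem : ∀ r ∈ rs, r ∈ I) (reg : IsWeaklyRegular A rs) :
    ¬ HasProjectiveDimensionLT (of A (A ⧸ I)) rs.length := by
  intro hpd
  have key (n : ℕ) (L : Type u) [AddCommGroup L] [Module A L] [Module.Finite A L] (i : ℕ)
      (hi : rs.length ≤ i + n) : Subsingleton (Ext (of A (A ⧸ I)) (of A L) i) := by
    induction n generalizing L i with
    | zero => exact HasProjectiveDimensionLT.subsingleton _ rs.length i hi _
    | succ n ih =>
      rcases le_or_gt rs.length i with h | h
      · exact HasProjectiveDimensionLT.subsingleton _ rs.length i h _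
      obtain ⟨k, f, hf⟩ := Module.Finite.exists_fin' A L
      have hS := LinearMap.shortExact_shortComplexKer hf
      have h₁ : Subsingleton (Ext (of A (A ⧸ I)) (of A f.ker) (i + 1)) := ih f.ker (i + 1) (by lia)
      have h₂ := subsingleton_ext_quotient_pi hI mem reg k i h
      refine subsingleton_of_forall_eq 0 fun x ↦ ?_
      obtain ⟨y, rfl⟩ := Ext.covariant_sequence_exact₃ _ hS x rfl (h₁.elim _ _)
      rw [h₂.elim y 0, Ext.zero_comp]
  have := key rs.length (A ⧸ I) 0 (by lia)
  have hid : 𝟙 (of A (A ⧸ I)) = 0 := Ext.homEquiv₀.symm.injective (Subsingleton.elim _ _)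
  have := subsingleton_of_isZero ((Limits.IsZero.iff_id_eq_zero _).mpr hid)
  exact hI (Ideal.Quotient.subsingleton_iff.mp this)

end ModuleCat

/-- An element outside `I` killed modulo `I` by a maximal ideal `m` embeds `R ⧸ m` into `R ⧸ I`. -/
lemma Ideal.exists_injective_quotient_of_smul_mem {R : Type*} [CommRing R] {m I : Ideal R}
    [hm : m.IsMaximal] {s : R} (hs : s ∉ I) (h : ∀ r ∈ m, r * s ∈ I) :
    ∃ f : (R ⧸ m) →ₗ[R] (R ⧸ I), Function.Injective f := by
  let g : R →ₗ[R] (R ⧸ I) := LinearMap.toSpanSingleton R (R ⧸ I) (Ideal.Quotient.mk I s)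
  have hg (r : R) : g r = Ideal.Quotient.mk I (r * s) := by
    rw [map_mul]
    exact Algebra.smul_def _ _
  have hle : m ≤ g.ker := fun r hr ↦ by
    rw [LinearMap.mem_ker, hg, Ideal.Quotient.eq_zero_iff_mem]
    exact h r hr
  have hne : g.ker ≠ ⊤ := fun htop ↦ hs <| by
    have h₁ : (1 : R) ∈ g.ker := htop ▸ Submodule.mem_top
    rwa [LinearMap.mem_ker, hg, Ideal.Quotient.eq_zero_iff_mem, one_mul] at h₁
  refine ⟨Submodule.liftQ m g hle, LinearMap.ker_eq_bot.mp ?_⟩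
  exact Submodule.ker_liftQ_eq_bot _ _ _ (hm.eq_of_le hne hle).ge

section ThreeCubics

variable (K : Type*) [Field K]

/-- The ideal generated by the cubics `X₀³`, `X₁³` and `X₀² X₂ + X₀ X₁ X₃ + X₁² X₄`. -/
noncomputable def threeCubics : Ideal (MvPolynomial (Fin 5) K) :=
  Ideal.span {X 0 ^ 3, X 1 ^ 3, X 0 ^ 2 * X 2 + X 0 * X 1 * X 3 + X 1 ^ 2 * X 4}

lemma X_mul_mem_threeCubics (i : Fin 5) : X i * (X 0 ^ 2 * X 1 ^ 2) ∈ threeCubics K := by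
  have key (p a b c : MvPolynomial (Fin 5) K) (h : p = a * X 0 ^ 3 + (b * X 1 ^ 3 +
      c * (X 0 ^ 2 * X 2 + X 0 * X 1 * X 3 + X 1 ^ 2 * X 4))) : p ∈ threeCubics K :=
    Ideal.mem_span_insert.mpr ⟨a, _, Ideal.mem_span_pair.mpr ⟨b, c, rfl⟩, h⟩
  fin_cases i
  · exact key _ (X 1 ^ 2) 0 0 (by simp; ring)
  · exact key _ 0 (X 0 ^ 2) 0 (by simp; ring)
  · exact key _ 0 (- (X 0 * X 3) - X 1 * X 4) (X 1 ^ 2) (by simp; ring)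
  · exact key _ (- (X 1 * X 2)) (- (X 0 * X 4)) (X 0 * X 1) (by simp; ring)
  · exact key _ (- (X 0 * X 2) - X 1 * X 3) 0 (X 0 ^ 2) (by simp; ring)

lemma X_sq_mul_X_sq_notMem_threeCubics : X 0 ^ 2 * X 1 ^ 2 ∉ threeCubics K := by
  let S : Set (Fin 5 →₀ ℕ) := {Finsupp.single 0 3, Finsupp.single 1 3, Finsupp.single 2 1,
    Finsupp.single 3 1, Finsupp.single 4 1}
  let J : Ideal (MvPolynomial (Fin 5) K) := Ideal.span ((fun s ↦ monomial s (1 : K)) '' S)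
  have hJ {s : Fin 5 →₀ ℕ} (hs : s ∈ S) : monomial s (1 : K) ∈ J :=
    Ideal.subset_span (Set.mem_image_of_mem _ hs)
  have hle : threeCubics K ≤ J := by
    refine Ideal.span_le.mpr ?_
    rintro _ (rfl | rfl | rfl)
    · rw [X_pow_eq_monomial]
      exact hJ (by simp [S])
    · rw [X_pow_eq_monomial]
      exact hJ (by simp [S])
    · exact add_mem (add_mem (J.mul_mem_left _ (hJ (by simp [S])))
        (J.mul_mem_left _ (hJ (by simp [S])))) (J.mul_mem_left _ (hJ (by simp [S])))
  intro h
  have h := hle h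
  rw [X_pow_eq_monomial, X_pow_eq_monomial, monomial_mul, one_mul,
    mem_ideal_span_monomial_image] at h
  obtain ⟨s, hs, hle⟩ := h (Finsupp.single 0 2 + Finsupp.single 1 2) (by simp [mem_support_iff])
  rcases hs with rfl | rfl | rfl | rfl | rfl <;> simp at hle

lemma mul_mem_threeCubics {r : MvPolynomial (Fin 5) K} (hr : r ∈ idealOfVars (Fin 5) K) :
    r * (X 0 ^ 2 * X 1 ^ 2) ∈ threeCubics K := by
  have hle : idealOfVars (Fin 5) K ≤ Submodule.comap
      (LinearMap.mulRight (MvPolynomial (Fin 5) K) (X 0 ^ 2 * X 1 ^ 2)) (threeCubics K) := by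
    refine Ideal.span_le.mpr ?_
    rintro _ ⟨i, rfl⟩
    exact X_mul_mem_threeCubics K i
  exact hle hr

lemma not_hasProjectiveDimensionLT_quotient_threeCubics :
    ¬ HasProjectiveDimensionLT (ModuleCat.of (MvPolynomial (Fin 5) K)
      (MvPolynomial (Fin 5) K ⧸ threeCubics K)) 5 := by
  intro hpd
  obtain ⟨f, hf⟩ := Ideal.exists_injective_quotient_of_smul_mem
    (X_sq_mul_X_sq_notMem_threeCubics K) fun _ ↦ mul_mem_threeCubics K
  let S : ShortComplex (ModuleCat (MvPolynomial (Fin 5) K)) := ShortComplex.mk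
    (ModuleCat.ofHom f) (ModuleCat.ofHom f.range.mkQ) (by
      ext : 1
      exact LinearMap.range_mkQ_comp f)
  have hS : S.ShortExact :=
    { exact := (ShortComplex.ShortExact.moduleCat_exact_iff_function_exact _).mpr
        (LinearMap.exact_map_mkQ_range f)
      mono_f := (ModuleCat.mono_iff_injective _).mpr hf
      epi_g := (ModuleCat.epi_iff_surjective _).mpr f.range.mkQ_surjective }
  have h₃ : HasProjectiveDimensionLT S.X₃ 6 := MvPolynomial.hasProjectiveDimensionLE K 5 _
  have h₁ : HasProjectiveDimensionLT S.X₁ 5 := hS.hasProjectiveDimensionLT_X₁ 5 hpd h₃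
  refine ModuleCat.not_hasProjectiveDimensionLT_quotient_of_isWeaklyRegular
    (Ideal.IsMaximal.ne_top (isMaximal_idealOfVars (Fin 5) K)) (fun r hr ↦ ?_)
    (isWeaklyRegular_ofFn_X K 5) ?_
  · exact Ideal.subset_span ((List.mem_ofFn' _ _).mp hr)
  · rwa [List.length_ofFn]

end ThreeCubics

/-- In `R = K[X₁,X₂,Y₁,Y₂,Y₃]` with
`I = (X₁³, X₂³, X₁²Y₁ + X₁X₂Y₂ + X₂²Y₃)`, the projective dimension of `R/I`
is `5`, the number of variables of `R`; in particular `I` is generated by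
3 cubics and has projective dimension `5`. -/
theorem three_cubics_pd_five (K : Type*) [Field K] :
    let R := MvPolynomial (Fin 5) K
    let I : Ideal R := Ideal.span
      {X 0 ^ 3, X 1 ^ 3, X 0 ^ 2 * X 2 + X 0 * X 1 * X 3 + X 1 ^ 2 * X 4}
    projDim R (R ⧸ I) = 5 := by
  intro R I
  have : HasProjectiveDimensionLE (ModuleCat.of R (R ⧸ I)) 5 :=
    MvPolynomial.hasProjectiveDimensionLE K 5 (R ⧸ I)
  exact projDim_eq_of_hasProjectiveDimensionLE 5
    (not_hasProjectiveDimensionLT_quotient_threeCubics K)
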